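/- Assume the standard setup with r ≥ 2, and suppose c_{j−1} = e < c_j for some 3 ≤ j ≤ r and b = j − 1. Assume e + s·nᵢ ≥ c_r if i < r and e + s·nᵢ ≥ c_{r−1} if i = r, where s ≥ 1 if nᵢ = 1 and s ≥ 2 is even if nᵢ ≥ 2. Then χ_la(G(Vᵢ,s)) = s·nᵢ + t − r + j − 1 for every 1 ≤ i ≤ j − 1, and χ_la(G(Vᵢ,s)) = s·nᵢ + t − r + j for every j ≤ i ≤ r. -/

import Mathlib

open Finset
open scoped Classical

namespace LocalAntimagic

variable {V : Type*}

/-- The induced vertex label: sum of the labels of edges incident to `v`. -/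
noncomputable def vertexSum [Fintype V] (G : SimpleGraph V) (f : Sym2 V → ℕ) (v : V) : ℕ :=
  ∑ e ∈ G.incidenceFinset v, f e

/-- `f` is a local antimagic labeling of `G`: a bijection from the edge set onto
`{1, …, |E|}` whose induced vertex labels distinguish adjacent vertices. -/
def IsLocalAntimagic [Fintype V] (G : SimpleGraph V) (f : Sym2 V → ℕ) : Prop :=
  Set.BijOn f G.edgeSet (Set.Icc 1 G.edgeFinset.card) ∧
  ∀ ⦃u v : V⦄, G.Adj u v → vertexSum G f u ≠ vertexSum G f v

/-- The color number `c(f)`: the number of distinct induced vertex labels. -/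
noncomputable def colorCount [Fintype V] (G : SimpleGraph V) (f : Sym2 V → ℕ) : ℕ :=
  (Finset.univ.image (vertexSum G f)).card

/-- The local antimagic chromatic number. -/
noncomputable def chiLA [Fintype V] (G : SimpleGraph V) : ℕ :=
  sInf {n | ∃ f, IsLocalAntimagic G f ∧ colorCount G f = n}

/-- A pendant vertex is a vertex of degree 1. -/
def IsPendant [Fintype V] (G : SimpleGraph V) (v : V) : Prop :=
  G.degree v = 1

/-- The number of pendant vertices of `G`. -/
noncomputable def pendantCount [Fintype V] (G : SimpleGraph V) : ℕ :=
  (Finset.univ.filter (fun v => IsPendant G v)).card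

/-- `G(S, s)`: the graph obtained from `G` by attaching `s` new pendant edges to every
vertex of `S`.  The new pendant vertex attached to `w ∈ S` via the `j`-th new edge is
`Sum.inr (w, j)`; the original graph lives on the `Sum.inl` vertices. -/
def attachPendants (G : SimpleGraph V) (S : Finset V) (s : ℕ) :
    SimpleGraph (V ⊕ (S × Fin s)) :=
  SimpleGraph.fromRel (fun a b =>
    (∃ u v : V, a = Sum.inl u ∧ b = Sum.inl v ∧ G.Adj u v) ∨
    (∃ (w : S) (j : Fin s), a = Sum.inl (w : V) ∧ b = Sum.inr (w, j)))

/-- The standard setup: `G` is a connected graph with at least `2` edges and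
`χ_la(G) = t ≥ 2`; `f` is a local antimagic labeling of `G` with `c(f) = t` whose color
classes are `Vset 1, …, Vset t` (each nonempty, with `f⁺ ≡ c i` on `Vset i`, and the
colors `c 1, …, c t` pairwise distinct); every non-pendant vertex lies in
`Vset 1 ∪ ⋯ ∪ Vset r` where `1 ≤ r ≤ t`; each `Vset i` with `r + 1 ≤ i ≤ t` is a
singleton consisting of a pendant vertex; `c 1 < c 2 < ⋯ < c r` and
`c (r+1) < c (r+2) < ⋯ < c t`. -/
structure StandardSetup [Fintype V] (G : SimpleGraph V) (f : Sym2 V → ℕ)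
    (t r : ℕ) (Vset : ℕ → Finset V) (c : ℕ → ℕ) : Prop where
  connected : G.Connected
  two_le_card_edges : 2 ≤ G.edgeFinset.card
  chiLA_eq : chiLA G = t
  two_le_t : 2 ≤ t
  antimagic : IsLocalAntimagic G f
  colorCount_eq : colorCount G f = t
  color_on_class : ∀ i ∈ Finset.Icc 1 t, ∀ v ∈ Vset i, vertexSum G f v = c i
  class_cover : ∀ v : V, ∃ i ∈ Finset.Icc 1 t, v ∈ Vset i
  class_nonempty : ∀ i ∈ Finset.Icc 1 t, (Vset i).Nonempty
  color_injective : ∀ i ∈ Finset.Icc 1 t, ∀ j ∈ Finset.Icc 1 t, i ≠ j → c i ≠ c j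
  one_le_r : 1 ≤ r
  r_le_t : r ≤ t
  nonpendant_mem : ∀ v : V, ¬ IsPendant G v → ∃ i ∈ Finset.Icc 1 r, v ∈ Vset i
  pendant_singleton : ∀ i ∈ Finset.Icc (r + 1) t, ∃ v : V, IsPendant G v ∧ Vset i = {v}
  c_strictMono_low : ∀ i j : ℕ, 1 ≤ i → i < j → j ≤ r → c i < c j
  c_strictMono_high : ∀ i j : ℕ, r + 1 ≤ i → i < j → j ≤ t → c i < c j

/-- `b`: the number of pendant vertices of `G` lying in `Vset 1 ∪ ⋯ ∪ Vset r`. -/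
noncomputable def pendantsInLow [Fintype V] (G : SimpleGraph V)
    (Vset : ℕ → Finset V) (r : ℕ) : ℕ :=
  (((Finset.Icc 1 r).biUnion Vset).filter (fun v => IsPendant G v)).card

/-- The induced vertex label as a sum over all vertices. -/
theorem vertexSum_eq_sum_adj [Fintype V] (G : SimpleGraph V) (f : Sym2 V → ℕ) (v : V) :
    vertexSum G f v = ∑ w, if G.Adj v w then f s(v, w) else 0 := by
  rw [vertexSum, ← Finset.sum_filter]
  symm
  refine Finset.sum_bij (fun w _ => s(v, w)) ?_ ?_ ?_ ?_
  · intro w hw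
    simpa [SimpleGraph.mem_incidenceFinset, SimpleGraph.mem_incidenceSet] using hw
  · intro a _ b _ h
    exact Sym2.congr_right.1 h
  · intro x hx
    rw [SimpleGraph.mem_incidenceFinset] at hx
    obtain ⟨hx, hv⟩ := hx
    obtain ⟨w, rfl⟩ := Sym2.mem_iff_exists.1 hv
    exact ⟨w, by simpa using hx, rfl⟩
  · intros
    rfl

theorem isPendant_iff [Fintype V] (G : SimpleGraph V) (v : V) :
    IsPendant G v ↔ ∃! w, G.Adj v w :=
  SimpleGraph.degree_eq_one_iff_existsUnique_adj

theorem vertexSum_of_unique_adj [Fintype V] {G : SimpleGraph V} (f : Sym2 V → ℕ) {v w : V}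
    (hvw : G.Adj v w) (huniq : ∀ y, G.Adj v y → y = w) : vertexSum G f v = f s(v, w) := by
  rw [vertexSum_eq_sum_adj, Finset.sum_eq_single w]
  · simp [hvw]
  · intro y _ hy
    exact if_neg fun h => hy (huniq y h)
  · simp

namespace IsLocalAntimagic

variable [Fintype V] {G : SimpleGraph V} {f : Sym2 V → ℕ}

theorem one_le (hf : IsLocalAntimagic G f) {v w : V} (h : G.Adj v w) : 1 ≤ f s(v, w) :=
  (hf.1.mapsTo (show s(v, w) ∈ G.edgeSet from h)).1

theorem le_card (hf : IsLocalAntimagic G f) {v w : V} (h : G.Adj v w) :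
    f s(v, w) ≤ G.edgeFinset.card :=
  (hf.1.mapsTo (show s(v, w) ∈ G.edgeSet from h)).2

theorem vertexSum_pos (hf : IsLocalAntimagic G f) {v w : V} (h : G.Adj v w) :
    0 < vertexSum G f v := by
  rw [vertexSum_eq_sum_adj]
  refine Finset.sum_pos' (fun _ _ => Nat.zero_le _) ⟨w, Finset.mem_univ _, ?_⟩
  rw [if_pos h]
  exact hf.one_le h

theorem vertexSum_le_of_isPendant (hf : IsLocalAntimagic G f) {v : V} (hv : IsPendant G v) :
    vertexSum G f v ≤ G.edgeFinset.card := by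
  obtain ⟨w, hw, hu⟩ := (isPendant_iff G v).1 hv
  rw [vertexSum_of_unique_adj f hw hu]
  exact hf.le_card hw

/-- Distinct pendant vertices receive distinct induced labels. -/
theorem injOn_isPendant (hf : IsLocalAntimagic G f) :
    Set.InjOn (vertexSum G f) {v | IsPendant G v} := by
  intro u hu v hv h
  obtain ⟨x, hx, hxu⟩ := (isPendant_iff G u).1 hu
  obtain ⟨y, hy, hyu⟩ := (isPendant_iff G v).1 hv
  have h' := h
  rw [vertexSum_of_unique_adj f hx hxu, vertexSum_of_unique_adj f hy hyu] at h'
  have := hf.1.injOn (show s(u, x) ∈ G.edgeSet from hx) (show s(v, y) ∈ G.edgeSet from hy) h'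
  rw [Sym2.eq_iff] at this
  rcases this with ⟨h1, _⟩ | ⟨_, rfl⟩
  · exact h1
  · exact absurd h (hf.2 hx)

/-- A non-pendant endpoint of the edge with the largest label has a label larger than `|E|`. -/
theorem card_lt_vertexSum (hf : IsLocalAntimagic G f) {x y : V} (hxy : G.Adj x y)
    (hlab : f s(x, y) = G.edgeFinset.card) (hx : ¬ IsPendant G x) :
    G.edgeFinset.card < vertexSum G f x := by
  obtain ⟨z, hz, hzy⟩ : ∃ z, G.Adj x z ∧ z ≠ y := by
    by_contra! h
    exact hx ((isPendant_iff G x).2 ⟨y, hxy, h⟩)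
  have hle : ∑ w ∈ {y, z}, (if G.Adj x w then f s(x, w) else 0) ≤ vertexSum G f x := by
    rw [vertexSum_eq_sum_adj]
    exact Finset.sum_le_sum_of_subset (Finset.subset_univ _)
  rw [Finset.sum_pair hzy.symm, if_pos hxy, if_pos hz, hlab] at hle
  have := hf.one_le hz
  omega

theorem pendantCount_lt_colorCount (hf : IsLocalAntimagic G f) (hE : 1 ≤ G.edgeFinset.card) :
    pendantCount G < colorCount G f := by
  obtain ⟨ed, hed, hlab⟩ := hf.1.surjOn (show G.edgeFinset.card ∈ Set.Icc 1 _ from ⟨hE, le_rfl⟩)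
  obtain ⟨x, hx⟩ : ∃ x, G.edgeFinset.card < vertexSum G f x := by
    induction ed with | _ u v =>
    have huv : G.Adj u v := hed
    by_cases hu : IsPendant G u
    · refine ⟨v, hf.card_lt_vertexSum huv.symm (by rwa [Sym2.eq_swap]) fun hv => ?_⟩
      obtain ⟨a, ha, hau⟩ := (isPendant_iff G u).1 hu
      obtain ⟨b, hb, hbu⟩ := (isPendant_iff G v).1 hv
      obtain rfl := hau v huv
      obtain rfl := hbu u huv.symm
      refine hf.2 huv ?_
      rw [vertexSum_of_unique_adj f huv hau, vertexSum_of_unique_adj f huv.symm hbu, Sym2.eq_swap]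
    · exact ⟨u, hf.card_lt_vertexSum huv hlab hu⟩
  have hcard : pendantCount G
      = ((Finset.univ.filter fun v => IsPendant G v).image (vertexSum G f)).card := by
    rw [Finset.card_image_of_injOn]
    · rfl
    · simpa using hf.injOn_isPendant
  rw [hcard, colorCount]
  refine Finset.card_lt_card (Finset.ssubset_iff_of_subset
    (Finset.image_subset_image (Finset.filter_subset _ _)) |>.2
    ⟨vertexSum G f x, Finset.mem_image_of_mem _ (Finset.mem_univ _), fun h => ?_⟩)
  obtain ⟨v, hv, hvx⟩ := Finset.mem_image.1 h
  have := hf.vertexSum_le_of_isPendant (Finset.mem_filter.1 hv).2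
  omega

end IsLocalAntimagic

section AttachPendants

variable (G : SimpleGraph V) (S : Finset V) (s : ℕ)

@[simp] theorem attachPendants_adj_inl_inl (u v : V) :
    (attachPendants G S s).Adj (Sum.inl u) (Sum.inl v) ↔ G.Adj u v := by
  simp only [attachPendants, SimpleGraph.fromRel_adj]
  constructor
  · rintro ⟨_, (⟨a, b, ha, hb, h⟩ | ⟨w, k, _, h⟩) | (⟨a, b, ha, hb, h⟩ | ⟨w, k, _, h⟩)⟩
    · cases ha; cases hb; exact h
    · cases h
    · cases ha; cases hb; exact h.symm
    · cases h
  · intro h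
    exact ⟨fun e => h.ne (Sum.inl_injective e), Or.inl (Or.inl ⟨u, v, rfl, rfl, h⟩)⟩

@[simp] theorem attachPendants_adj_inl_inr (v : V) (p : S × Fin s) :
    (attachPendants G S s).Adj (Sum.inl v) (Sum.inr p) ↔ v = p.1 := by
  simp only [attachPendants, SimpleGraph.fromRel_adj]
  constructor
  · rintro ⟨_, (⟨a, b, ha, hb, h⟩ | ⟨w, k, h, h'⟩) | (⟨a, b, ha, hb, h⟩ | ⟨w, k, h, h'⟩)⟩
    · cases hb
    · cases h; cases h'; rfl
    · cases ha
    · cases h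
  · rintro rfl
    exact ⟨by simp, Or.inl (Or.inr ⟨p.1, p.2, rfl, rfl⟩)⟩

@[simp] theorem attachPendants_adj_inr_inl (v : V) (p : S × Fin s) :
    (attachPendants G S s).Adj (Sum.inr p) (Sum.inl v) ↔ v = p.1 := by
  rw [SimpleGraph.adj_comm, attachPendants_adj_inl_inr]

@[simp] theorem attachPendants_adj_inr_inr (p q : S × Fin s) :
    ¬ (attachPendants G S s).Adj (Sum.inr p) (Sum.inr q) := by
  simp [attachPendants]

theorem isPendant_attachPendants_inr [Fintype V] (p : S × Fin s) :
    IsPendant (attachPendants G S s) (Sum.inr p) := by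
  refine (isPendant_iff _ _).2 ⟨Sum.inl p.1, by simp, ?_⟩
  rintro (v | q) h
  · rw [attachPendants_adj_inr_inl] at h
    rw [h]
  · exact absurd h (attachPendants_adj_inr_inr G S s p q)

theorem isPendant_attachPendants_inl [Fintype V] {v : V} (hv : IsPendant G v) (hS : v ∉ S) :
    IsPendant (attachPendants G S s) (Sum.inl v) := by
  obtain ⟨w, hw, hu⟩ := (isPendant_iff G v).1 hv
  refine (isPendant_iff _ _).2 ⟨Sum.inl w, by simpa using hw, ?_⟩
  rintro (x | q) h
  · rw [hu x (by simpa using h)]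
  · rw [attachPendants_adj_inl_inr] at h
    exact absurd q.1.2 (h ▸ hS)

theorem le_pendantCount_attachPendants [Fintype V] :
    s * S.card + ((Finset.univ.filter fun v => IsPendant G v) \ S).card
      ≤ pendantCount (attachPendants G S s) := by
  have h : ((Finset.univ.filter fun v => IsPendant G v) \ S).disjSum
      (Finset.univ : Finset (S × Fin s))
      ⊆ Finset.univ.filter fun v => IsPendant (attachPendants G S s) v := by
    rintro (v | p) hx
    · rw [Finset.inl_mem_disjSum, Finset.mem_sdiff, Finset.mem_filter] at hx
      simpa using isPendant_attachPendants_inl G S s hx.1.2 hx.2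
    · simpa using isPendant_attachPendants_inr G S s p
  have := Finset.card_le_card h
  rw [Finset.card_disjSum, Finset.card_univ, Fintype.card_prod, Fintype.card_coe,
    Fintype.card_fin, mul_comm S.card] at this
  rw [pendantCount]
  omega

/-- The edge labeling of `G(S, s)` that agrees with `f` on `G` and labels new pendant edges
by `l`. -/
def extendLabel {S : Finset V} {s : ℕ} (f : Sym2 V → ℕ) (l : S × Fin s → ℕ) :
    Sym2 (V ⊕ (S × Fin s)) → ℕ :=
  Sym2.lift ⟨fun a b => match a, b with
    | Sum.inl u, Sum.inl v => f s(u, v)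
    | Sum.inl _, Sum.inr p => l p
    | Sum.inr p, Sum.inl _ => l p
    | Sum.inr _, Sum.inr _ => 0, by
      rintro (u | p) (v | q)
      · exact congrArg f Sym2.eq_swap
      all_goals rfl⟩

end AttachPendants

theorem sum_even_ite_const {m : ℕ} (n a : ℕ) (ha : a < n) :
    ∑ k ∈ Finset.range (2 * m), (if Even k then a else n - 1 - a) = m * (n - 1) := by
  induction m with
  | zero => simp
  | succ m ih =>
    rw [mul_add, mul_one, Finset.sum_range_succ, Finset.sum_range_succ, ih, if_pos (by simp),
      if_neg (by simp)]
    rw [add_mul]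
    omega

/-- The integers `e + 1, …, e + s * n` can be arranged in an array with `s` columns and `n` rows
of equal sum if `n = 1` or `s` is even. -/
theorem exists_balanced_array {α : Type*} [Fintype α] (e s : ℕ)
    (hs : Fintype.card α = 1 ∨ Even s) :
    ∃ l : α × Fin s → ℕ, Set.BijOn l Set.univ (Set.Icc (e + 1) (e + s * Fintype.card α)) ∧
      ∃ T, ∀ a, ∑ k, l (a, k) = T := by
  set n := Fintype.card α with hn
  let φ : α ≃ Fin n := Fintype.equivFin α
  let x : α → ℕ → ℕ := fun a k => if Even k then (φ a : ℕ) else n - 1 - φ a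
  have hx : ∀ a k, x a k < n := by
    intro a k
    have := (φ a).2
    simp only [x]
    split_ifs <;> omega
  let l : α × Fin s → ℕ := fun p => e + 1 + (p.2 * n + x p.1 p.2)
  have hinj : Function.Injective l := by
    rintro ⟨a, k⟩ ⟨a', k'⟩ h
    have h1 : (k : ℕ) * n + x a k = k' * n + x a' k' := by
      simpa [l] using h
    have hpos : 0 < n := (Nat.zero_le _).trans_lt (hx a 0)
    have hk : (k : ℕ) = k' := by
      have h2 := congrArg (· / n) h1
      simpa [Nat.add_div_of_dvd_right, Nat.div_eq_of_lt, hx, hpos] using h2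
    obtain rfl := Fin.ext hk
    have h3 : x a k = x a' k := by omega
    have h4 := (φ a).2
    have h5 := (φ a').2
    have h6 : (φ a : ℕ) = φ a' := by
      simp only [x] at h3
      split_ifs at h3 <;> omega
    rw [φ.injective (Fin.ext h6)]
  have hmaps : ∀ p, l p ∈ Finset.Icc (e + 1) (e + s * n) := by
    rintro ⟨a, k⟩
    have h1 := hx a k
    have h2 : ((k : ℕ) + 1) * n ≤ s * n := Nat.mul_le_mul_right _ k.2
    rw [add_mul] at h2
    simp only [l, Finset.mem_Icc]
    omega
  refine ⟨l, ⟨fun p _ => by simpa using hmaps p, hinj.injOn, ?_⟩, ?_⟩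
  · have := Finset.surjOn_of_injOn_of_card_le (s := (Finset.univ : Finset (α × Fin s)))
      (t := Finset.Icc (e + 1) (e + s * n)) l (fun p _ => by simpa using hmaps p) hinj.injOn
      (by simp [← hn, mul_comm])
    simpa using this
  · have key : ∃ T, ∀ a, ∑ k ∈ Finset.range s, x a k = T := by
      rcases hs with h | ⟨m, rfl⟩
      · refine ⟨0, fun a => Finset.sum_eq_zero fun k _ => ?_⟩
        have := hx a k
        omega
      · refine ⟨m * (n - 1), fun a => ?_⟩
        rw [← two_mul]
        exact sum_even_ite_const n _ (φ a).2
    obtain ⟨T, hT⟩ := key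
    refine ⟨∑ k : Fin s, (e + 1 + (k : ℕ) * n) + T, fun a => ?_⟩
    rw [← hT a, ← Fin.sum_univ_eq_sum_range, ← Finset.sum_add_distrib]
    exact Finset.sum_congr rfl fun k _ => by simp only [l]; ring

theorem bijOn_image_of_comp {α β γ : Type*} {φ : α → β} {g : β → γ} {A : Set α} {B : Set γ}
    (h : Set.BijOn (g ∘ φ) A B) : Set.BijOn g (φ '' A) B := by
  refine ⟨?_, h.injOn.image_of_comp, ?_⟩
  · rintro _ ⟨x, hx, rfl⟩
    exact h.mapsTo hx
  · intro y hy
    obtain ⟨x, hx, rfl⟩ := h.surjOn hy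
    exact ⟨φ x, ⟨x, hx, rfl⟩, rfl⟩

theorem edgeSet_attachPendants (G : SimpleGraph V) (S : Finset V) (s : ℕ) :
    (attachPendants G S s).edgeSet = Sym2.map Sum.inl '' G.edgeSet ∪
      (fun p : S × Fin s => s(Sum.inl (p.1 : V), Sum.inr p)) '' Set.univ := by
  ext ed
  constructor
  · intro h
    induction ed with | _ a b =>
    rw [SimpleGraph.mem_edgeSet] at h
    rcases a with u | p <;> rcases b with v | q
    · exact Or.inl ⟨s(u, v), by simpa using h, rfl⟩
    · rw [attachPendants_adj_inl_inr] at h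
      exact Or.inr ⟨q, trivial, by rw [h]⟩
    · rw [attachPendants_adj_inr_inl] at h
      exact Or.inr ⟨p, trivial, by rw [h, Sym2.eq_swap]⟩
    · exact absurd h (attachPendants_adj_inr_inr G S s p q)
  · rintro (⟨x, hx, rfl⟩ | ⟨p, _, rfl⟩)
    · induction x with | _ u v =>
      simpa using hx
    · simp

theorem bijOn_extendLabel {G : SimpleGraph V} {S : Finset V} {s m n : ℕ} {f : Sym2 V → ℕ}
    {l : S × Fin s → ℕ} (hf : Set.BijOn f G.edgeSet (Set.Icc 1 m))
    (hl : Set.BijOn l Set.univ (Set.Icc (m + 1) (m + n))) :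
    Set.BijOn (extendLabel f l) (attachPendants G S s).edgeSet (Set.Icc 1 (m + n)) := by
  have h1 : Set.BijOn (extendLabel f l) (Sym2.map Sum.inl '' G.edgeSet) (Set.Icc 1 m) := by
    refine bijOn_image_of_comp (hf.congr fun x _ => ?_)
    induction x with | _ u v => rfl
  have h2 : Set.BijOn (extendLabel f l)
      ((fun p : S × Fin s => s(Sum.inl (p.1 : V), Sum.inr p)) '' Set.univ)
      (Set.Icc (m + 1) (m + n)) := bijOn_image_of_comp hl
  have hI : Set.Icc 1 (m + n) = Set.Icc 1 m ∪ Set.Icc (m + 1) (m + n) := by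
    ext x
    simp only [Set.mem_Icc, Set.mem_union]
    omega
  rw [edgeSet_attachPendants, hI]
  refine h1.union h2 ?_
  rintro x (hx | hx) y (hy | hy) h
  · exact h1.injOn hx hy h
  · have := (h1.mapsTo hx).2
    have := (h2.mapsTo hy).1
    omega
  · have := (h2.mapsTo hx).1
    have := (h1.mapsTo hy).2
    omega
  · exact h2.injOn hx hy h

section ExtendLabel

variable [Fintype V] (G : SimpleGraph V) {S : Finset V} {s : ℕ} (f : Sym2 V → ℕ)
  (l : S × Fin s → ℕ)

theorem vertexSum_extendLabel_inr (p : S × Fin s) :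
    vertexSum (attachPendants G S s) (extendLabel f l) (Sum.inr p) = l p := by
  refine vertexSum_of_unique_adj (w := Sum.inl (p.1 : V)) _ (by simp) ?_
  rintro (v | q) h
  · rw [attachPendants_adj_inr_inl] at h
    rw [h]
  · exact absurd h (attachPendants_adj_inr_inr G S s p q)

theorem vertexSum_extendLabel_inl (v : V) :
    vertexSum (attachPendants G S s) (extendLabel f l) (Sum.inl v) =
      vertexSum G f v + ∑ a : S, ∑ k, if v = a then l (a, k) else 0 := by
  rw [vertexSum_eq_sum_adj, vertexSum_eq_sum_adj, Fintype.sum_sum_type, Fintype.sum_prod_type]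
  simp only [attachPendants_adj_inl_inl, attachPendants_adj_inl_inr]
  rfl

theorem vertexSum_extendLabel_of_notMem {v : V} (hv : v ∉ S) :
    vertexSum (attachPendants G S s) (extendLabel f l) (Sum.inl v) = vertexSum G f v := by
  rw [vertexSum_extendLabel_inl, Nat.add_eq_left]
  refine Finset.sum_eq_zero fun a _ => Finset.sum_eq_zero fun k _ => if_neg ?_
  rintro rfl
  exact hv a.2

theorem vertexSum_extendLabel_of_mem {v : V} (hv : v ∈ S) :
    vertexSum (attachPendants G S s) (extendLabel f l) (Sum.inl v) =
      vertexSum G f v + ∑ k, l (⟨v, hv⟩, k) := by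
  rw [vertexSum_extendLabel_inl, Finset.sum_eq_single ⟨v, hv⟩]
  · simp
  · intro a _ ha
    exact Finset.sum_eq_zero fun k _ => if_neg fun h => ha (Subtype.ext h.symm)
  · simp

end ExtendLabel

theorem card_edgeFinset_eq_of_bijOn [Fintype V] {G : SimpleGraph V} {g : Sym2 V → ℕ} {m : ℕ}
    (hg : Set.BijOn g G.edgeSet (Set.Icc 1 m)) : G.edgeFinset.card = m := by
  have h := congrArg Set.ncard hg.image_eq
  rw [hg.injOn.ncard_image, ← SimpleGraph.coe_edgeFinset, Set.ncard_coe_finset,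
    ← Finset.coe_Icc, Set.ncard_coe_finset, Nat.card_Icc] at h
  simpa using h

/-- A local antimagic labeling that is constant on `S` and not too large outside `S` extends
to `G(S, s)`. -/
theorem exists_extension [Fintype V] {G : SimpleGraph V} {f : Sym2 V → ℕ}
    (hf : IsLocalAntimagic G f) {S : Finset V} (hS : S.Nonempty) {s : ℕ} (hs : 1 ≤ s)
    (hpar : S.card = 1 ∨ Even s) {a : ℕ} (ha : 0 < a) (hconst : ∀ v ∈ S, vertexSum G f v = a)
    (hbig : ∀ v ∉ S, vertexSum G f v ≤ G.edgeFinset.card + s * S.card) :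
    ∃ g, IsLocalAntimagic (attachPendants G S s) g ∧
      (∃ T, ∀ v ∈ S, vertexSum (attachPendants G S s) g (Sum.inl v) = T) ∧
      (∀ v ∉ S, vertexSum (attachPendants G S s) g (Sum.inl v) = vertexSum G f v) ∧
      ∀ p, vertexSum (attachPendants G S s) g (Sum.inr p) ∈
        Finset.Icc (G.edgeFinset.card + 1) (G.edgeFinset.card + s * S.card) := by
  obtain ⟨l, hl, T, hT⟩ := exists_balanced_array (α := S) G.edgeFinset.card s
    (by rwa [Fintype.card_coe])
  rw [Fintype.card_coe] at hl
  have hmem : ∀ v ∈ S,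
      vertexSum (attachPendants G S s) (extendLabel f l) (Sum.inl v) = a + T := by
    intro v hv
    rw [vertexSum_extendLabel_of_mem G f l hv, hconst v hv, hT]
  have hTbig : G.edgeFinset.card + s * S.card ≤ T := by
    have hpos : 1 ≤ s * S.card := Nat.mul_pos hs hS.card_pos
    obtain ⟨⟨x, k⟩, _, hp⟩ := hl.surjOn
      (show G.edgeFinset.card + s * S.card ∈ Set.Icc _ _ from ⟨by omega, le_rfl⟩)
    rw [← hp, ← hT x]
    exact Finset.single_le_sum (f := fun k => l (x, k)) (fun _ _ => Nat.zero_le _)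
      (Finset.mem_univ k)
  have hbij := bijOn_extendLabel hf.1 hl
  refine ⟨extendLabel f l, ⟨?_, ?_⟩, ⟨a + T, hmem⟩,
    fun v hv => vertexSum_extendLabel_of_notMem G f l hv, fun p => ?_⟩
  · rwa [card_edgeFinset_eq_of_bijOn hbij]
  · have hout : ∀ p : S × Fin s, l p ≠ a + T := fun p => by
      have := (hl.mapsTo (Set.mem_univ p)).2
      omega
    rintro (u | p) (v | q) h
    · rw [attachPendants_adj_inl_inl] at h
      by_cases hu : u ∈ S <;> by_cases hv : v ∈ S
      · exact absurd ((hconst u hu).trans (hconst v hv).symm) (hf.2 h)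
      · rw [hmem u hu, vertexSum_extendLabel_of_notMem G f l hv]
        have := hbig v hv
        omega
      · rw [hmem v hv, vertexSum_extendLabel_of_notMem G f l hu]
        have := hbig u hu
        omega
      · rw [vertexSum_extendLabel_of_notMem G f l hu, vertexSum_extendLabel_of_notMem G f l hv]
        exact hf.2 h
    · rw [attachPendants_adj_inl_inr] at h
      rw [h, hmem _ q.1.2, vertexSum_extendLabel_inr]
      exact (hout q).symm
    · rw [attachPendants_adj_inr_inl] at h
      rw [h, hmem _ p.1.2, vertexSum_extendLabel_inr]
      exact hout p
    · exact absurd h (attachPendants_adj_inr_inr G S s p q)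
  · rw [vertexSum_extendLabel_inr]
    simpa using hl.mapsTo (Set.mem_univ p)

theorem chiLA_eq_of_le_pendantCount [Fintype V] {G : SimpleGraph V} {g : Sym2 V → ℕ} {n : ℕ}
    (hE : 1 ≤ G.edgeFinset.card) (hg : IsLocalAntimagic G g) (hle : colorCount G g ≤ n)
    (hn : n ≤ pendantCount G + 1) : chiLA G = n := by
  have hlow : ∀ h, IsLocalAntimagic G h → n ≤ colorCount G h := fun h hh =>
    hn.trans (hh.pendantCount_lt_colorCount hE)
  refine le_antisymm (Nat.sInf_le ⟨g, hg, le_antisymm hle (hlow g hg)⟩) ?_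
  refine le_csInf ⟨_, g, hg, rfl⟩ ?_
  rintro _ ⟨h, hh, rfl⟩
  exact hlow h hh

namespace StandardSetup

variable [Fintype V] {G : SimpleGraph V} {f : Sym2 V → ℕ} {t r : ℕ} {Vset : ℕ → Finset V}
  {c : ℕ → ℕ}

theorem vertexSum_pos (setup : StandardSetup G f t r Vset c) (v : V) : 0 < vertexSum G f v := by
  have hE : G.edgeFinset.Nonempty := Finset.card_pos.1 (by have := setup.two_le_card_edges; omega)
  obtain ⟨x, hx⟩ := hE
  induction x with | _ x y =>
  rw [SimpleGraph.mem_edgeFinset, SimpleGraph.mem_edgeSet] at hx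
  have : Nontrivial V := ⟨x, y, hx.ne⟩
  obtain ⟨w, hw⟩ := setup.connected.preconnected.exists_adj_of_nontrivial v
  exact setup.antimagic.vertexSum_pos hw

theorem le_card_pendants (setup : StandardSetup G f t r Vset c) :
    pendantsInLow G Vset r + (t - r) ≤ (Finset.univ.filter fun v => IsPendant G v).card := by
  have hlt := setup.r_le_t
  have hhigh : t - r ≤ ((Finset.univ.filter fun v => IsPendant G v).filter
      fun v => v ∉ (Finset.Icc 1 r).biUnion Vset).card := by
    have : Nonempty V := setup.connected.nonempty
    choose! w hw using setup.pendant_singleton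
    have hmem : ∀ k ∈ Finset.Icc (r + 1) t, vertexSum G f (w k) = c k := by
      intro k hk
      refine setup.color_on_class k ?_ _ (by simp [(hw k hk).2])
      simp only [Finset.mem_Icc] at hk ⊢
      omega
    have := Finset.card_le_card_of_injOn (s := Finset.Icc (r + 1) t)
      (t := (Finset.univ.filter fun v => IsPendant G v).filter
        fun v => v ∉ (Finset.Icc 1 r).biUnion Vset) w ?_ ?_
    · rw [Nat.card_Icc] at this
      omega
    · intro k hk
      have hk' : k ∈ Finset.Icc (r + 1) t := hk
      simp only [Finset.coe_filter, Finset.mem_filter, Finset.mem_univ, true_and,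
        Set.mem_ofPred_eq, Finset.mem_biUnion, not_exists, not_and]
      refine ⟨(hw k hk').1, fun i hi hwi => ?_⟩
      simp only [Finset.mem_Icc] at hi hk'
      refine setup.color_injective i (by simp; omega) k (by simp; omega) (by omega) ?_
      rw [← hmem k hk, setup.color_on_class i (by simp; omega) _ hwi]
    · intro k hk k' hk' h
      by_contra hne
      have hk1 : k ∈ Finset.Icc (r + 1) t := hk
      have hk2 : k' ∈ Finset.Icc (r + 1) t := hk'
      have hc : c k = c k' := by rw [← hmem k hk1, ← hmem k' hk2, h]
      simp only [Finset.mem_Icc] at hk1 hk2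
      exact setup.color_injective k (by simp; omega) k' (by simp; omega) hne hc
  have hlow : pendantsInLow G Vset r = ((Finset.univ.filter fun v => IsPendant G v).filter
      fun v => v ∈ (Finset.Icc 1 r).biUnion Vset).card := by
    rw [pendantsInLow]
    congr 1
    ext v
    simp [and_comm]
  rw [← Finset.card_filter_add_card_filter_not (s := Finset.univ.filter fun v => IsPendant G v)
    (fun v => v ∈ (Finset.Icc 1 r).biUnion Vset), ← hlow]
  omega

theorem card_pendants_inter_le_one (setup : StandardSetup G f t r Vset c) {i : ℕ}
    (hi : i ∈ Finset.Icc 1 t) :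
    ((Finset.univ.filter fun v => IsPendant G v) ∩ Vset i).card ≤ 1 := by
  rw [Finset.card_le_one]
  intro u hu v hv
  simp only [Finset.mem_inter, Finset.mem_filter, Finset.mem_univ, true_and] at hu hv
  exact setup.antimagic.injOn_isPendant hu.1 hv.1
    ((setup.color_on_class i hi u hu.2).trans (setup.color_on_class i hi v hv.2).symm)

theorem pendants_inter_eq_empty (setup : StandardSetup G f t r Vset c) {i : ℕ}
    (hi : i ∈ Finset.Icc 1 t) (hc : G.edgeFinset.card < c i) :
    (Finset.univ.filter fun v => IsPendant G v) ∩ Vset i = ∅ := by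
  rw [Finset.eq_empty_iff_forall_notMem]
  intro v hv
  simp only [Finset.mem_inter, Finset.mem_filter, Finset.mem_univ, true_and] at hv
  have := setup.antimagic.vertexSum_le_of_isPendant hv.1
  rw [setup.color_on_class i hi v hv.2] at this
  omega

/-- If the colors `c k` with `m < k ≤ r` lie above `|E|`, they are reused by new pendant vertices of
`G(Vᵢ, s)`; the bounds on `n` count the remaining colors and the pendant vertices. -/
theorem chiLA_attachPendants_eq (setup : StandardSetup G f t r Vset c) {i s m n : ℕ}
    (hi : 1 ≤ i) (hir : i ≤ r) (hs : 1 ≤ s) (hpar : (Vset i).card = 1 ∨ Even s)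
    (hbig : ∀ k, 1 ≤ k → k ≤ r → k ≠ i → c k ≤ G.edgeFinset.card + s * (Vset i).card)
    (hm : ∀ k, m < k → k ≤ r → G.edgeFinset.card < c k)
    (hup : s * (Vset i).card + (t - r) + ((Finset.Icc 1 m).erase i).card + 1 ≤ n)
    (hlow : n + ((Finset.univ.filter fun v => IsPendant G v) ∩ Vset i).card
      ≤ s * (Vset i).card + (t - r) + pendantsInLow G Vset r + 1) :
    chiLA (attachPendants G (Vset i) s) = n := by
  have hrt := setup.r_le_t
  have hit : i ∈ Finset.Icc 1 t := by simp; omega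
  have hclass : ∀ v ∉ Vset i, ∃ k ∈ Finset.Icc 1 t, k ≠ i ∧ vertexSum G f v = c k := by
    intro v hv
    obtain ⟨k, hk, hvk⟩ := setup.class_cover v
    exact ⟨k, hk, by rintro rfl; exact hv hvk, setup.color_on_class k hk v hvk⟩
  have hhigh : ∀ k ∈ Finset.Icc (r + 1) t, c k ≤ G.edgeFinset.card := by
    intro k hk
    obtain ⟨v, hv, hkv⟩ := setup.pendant_singleton k hk
    have hk' : k ∈ Finset.Icc 1 t := by simp only [Finset.mem_Icc] at hk ⊢; omega
    rw [← setup.color_on_class k hk' v (by simp [hkv])]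
    exact setup.antimagic.vertexSum_le_of_isPendant hv
  obtain ⟨v₀, hv₀⟩ := setup.class_nonempty i hit
  obtain ⟨g, hg, ⟨T, hT⟩, hgout, hgnew⟩ := exists_extension setup.antimagic ⟨v₀, hv₀⟩ hs hpar
    (a := c i) (setup.color_on_class i hit v₀ hv₀ ▸ setup.vertexSum_pos v₀)
    (setup.color_on_class i hit) (by
      intro v hv
      obtain ⟨k, hk, hki, hvk⟩ := hclass v hv
      rw [Finset.mem_Icc] at hk
      rw [hvk]
      by_cases hkr : k ≤ r
      · exact hbig k hk.1 hkr hki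
      · have := hhigh k (by simp; omega)
        omega)
  refine chiLA_eq_of_le_pendantCount ?_ hg (le_trans ?_ hup) ?_
  · have hne : (attachPendants G (Vset i) s).Adj (Sum.inl v₀) (Sum.inr (⟨v₀, hv₀⟩, ⟨0, hs⟩)) := by
      simp
    exact Finset.card_pos.2 ⟨s(_, _), SimpleGraph.mem_edgeFinset.2
      ((SimpleGraph.mem_edgeSet _).2 hne)⟩
  · have hsub : Finset.univ.image (vertexSum (attachPendants G (Vset i) s) g) ⊆
        insert T (Finset.Icc (G.edgeFinset.card + 1) (G.edgeFinset.card + s * (Vset i).card) ∪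
          (Finset.Icc (r + 1) t).image c ∪ ((Finset.Icc 1 m).erase i).image c) := by
      intro x hx
      obtain ⟨v | p, _, rfl⟩ := Finset.mem_image.1 hx
      · by_cases hv : v ∈ Vset i
        · rw [hT v hv]
          exact Finset.mem_insert_self _ _
        · refine Finset.mem_insert_of_mem ?_
          rw [hgout v hv]
          obtain ⟨k, hk, hki, hvk⟩ := hclass v hv
          rw [hvk]
          rw [Finset.mem_Icc] at hk
          by_cases hkr : k ≤ r
          · by_cases hkm : k ≤ m
            · refine Finset.mem_union_right _ (Finset.mem_image_of_mem c ?_)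
              simp [hki, hk.1, hkm]
            · refine Finset.mem_union_left _ (Finset.mem_union_left _ ?_)
              exact Finset.mem_Icc.2 ⟨hm k (by omega) hkr, hbig k hk.1 hkr hki⟩
          · refine Finset.mem_union_left _ (Finset.mem_union_right _ ?_)
            exact Finset.mem_image_of_mem c (by simp; omega)
      · exact Finset.mem_insert_of_mem
          (Finset.mem_union_left _ (Finset.mem_union_left _ (hgnew p)))
    have h0 := (Finset.card_le_card hsub).trans (Finset.card_insert_le _ _)
    have h1 := Finset.card_union_le
      (Finset.Icc (G.edgeFinset.card + 1) (G.edgeFinset.card + s * (Vset i).card) ∪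
          (Finset.Icc (r + 1) t).image c) (((Finset.Icc 1 m).erase i).image c)
    have h2 := Finset.card_union_le
      (Finset.Icc (G.edgeFinset.card + 1) (G.edgeFinset.card + s * (Vset i).card))
      ((Finset.Icc (r + 1) t).image c)
    have h3 := Finset.card_image_le (s := Finset.Icc (r + 1) t) (f := c)
    have h4 := Finset.card_image_le (s := (Finset.Icc 1 m).erase i) (f := c)
    rw [Nat.card_Icc] at h2 h3
    rw [colorCount]
    omega
  · have h1 := le_pendantCount_attachPendants G (Vset i) s
    have h2 := setup.le_card_pendants
    have h3 := Finset.card_sdiff_add_card_inter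
      (Finset.univ.filter fun v => IsPendant G v) (Vset i)
    omega

end StandardSetup

/-- Theorem 2.1(3), "moreover" part: in the standard setup with
`r ≥ 2`, if `c_{j-1} = e < c_j` for some `3 ≤ j ≤ r` and `b = j - 1`, and for each
`1 ≤ i ≤ r` we have `e + s·nᵢ ≥ c_r` when `i < r` and `e + s·nᵢ ≥ c_{r-1}` when
`i = r`, where `s ≥ 1` if `nᵢ = 1` and `s ≥ 2` is even if `nᵢ ≥ 2`, then
`χ_la(G(Vᵢ, s)) = s·nᵢ + t - r + j - 1` for every `1 ≤ i ≤ j - 1` and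
`χ_la(G(Vᵢ, s)) = s·nᵢ + t - r + j` for every `j ≤ i ≤ r`. -/
theorem chiLA_attachPendants_eq_cj [Fintype V] (G : SimpleGraph V)
    (f : Sym2 V → ℕ) (t r : ℕ) (Vset : ℕ → Finset V) (c : ℕ → ℕ)
    (setup : StandardSetup G f t r Vset c) (hr : 2 ≤ r)
    (e s j : ℕ) (he : G.edgeFinset.card = e)
    (hb : pendantsInLow G Vset r = j - 1)
    (hj₁ : 3 ≤ j) (hj₂ : j ≤ r)
    (hce₁ : c (j - 1) = e) (hce₂ : e < c j)
    (hbig₁ : ∀ i, 1 ≤ i → i < r → c r ≤ e + s * (Vset i).card)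
    (hbig₂ : c (r - 1) ≤ e + s * (Vset r).card)
    (hs₁ : ∀ i, 1 ≤ i → i ≤ r → (Vset i).card = 1 → 1 ≤ s)
    (hs₂ : ∀ i, 1 ≤ i → i ≤ r → 2 ≤ (Vset i).card → 2 ≤ s ∧ Even s) :
    (∀ i, 1 ≤ i → i ≤ j - 1 →
      chiLA (attachPendants G (Vset i) s) = s * (Vset i).card + (t - r) + (j - 1)) ∧
    (∀ i, j ≤ i → i ≤ r →
      chiLA (attachPendants G (Vset i) s) = s * (Vset i).card + (t - r) + j) := by
  subst he
  have hrt := setup.r_le_t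
  have hmono : ∀ k l, 1 ≤ k → k ≤ l → l ≤ r → c k ≤ c l := by
    intro k l hk hkl hl
    rcases hkl.eq_or_lt with rfl | h
    · exact le_rfl
    · exact (setup.c_strictMono_low k l hk h hl).le
  have hspos : ∀ i, 1 ≤ i → i ≤ r → 1 ≤ s ∧ ((Vset i).card = 1 ∨ Even s) := by
    intro i hi hir
    have hne := (setup.class_nonempty i (by simp; omega)).card_pos
    by_cases h1 : (Vset i).card = 1
    · exact ⟨hs₁ i hi hir h1, Or.inl h1⟩
    · have := hs₂ i hi hir (by omega)
      exact ⟨by omega, Or.inr this.2⟩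
  have hbig : ∀ i, 1 ≤ i → i ≤ r → ∀ k, 1 ≤ k → k ≤ r → k ≠ i →
      c k ≤ G.edgeFinset.card + s * (Vset i).card := by
    intro i hi hir k hk hkr hki
    rcases hir.eq_or_lt with rfl | h
    · exact (hmono k (i - 1) hk (by omega) (by omega)).trans hbig₂
    · exact (hmono k r hk hkr le_rfl).trans (hbig₁ i hi h)
  have hlarge : ∀ k, j - 1 < k → k ≤ r → G.edgeFinset.card < c k := fun k hjk hkr =>
    hce₂.trans_le (hmono j k (by omega) (by omega) hkr)
  constructor
  · intro i hi hij
    have hir : i ≤ r := by omega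
    have hone := setup.card_pendants_inter_le_one (i := i) (by simp; omega)
    refine setup.chiLA_attachPendants_eq hi hir (hspos i hi hir).1 (hspos i hi hir).2
      (hbig i hi hir) hlarge ?_ (by omega)
    rw [Finset.card_erase_of_mem (by simp; omega), Nat.card_Icc]
    omega
  · intro i hij hir
    have hi : 1 ≤ i := by omega
    have hnone := setup.pendants_inter_eq_empty (i := i) (by simp; omega)
      (hlarge i (by omega) hir)
    refine setup.chiLA_attachPendants_eq hi hir (hspos i hi hir).1 (hspos i hi hir).2
      (hbig i hi hir) hlarge ?_ (by rw [hnone, Finset.card_empty]; omega)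
    rw [Finset.erase_eq_of_notMem (by simp; omega), Nat.card_Icc]
    omega

end LocalAntimagic
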